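/- arXiv:2305.19206 — 2 statements merged into one kernel-verified Lean document; each statement's English description precedes it below -/
import Mathlib

section
/- Suppose λ₁* > 0, η ≤ 1/(12·λ₁*), and σ₁(X_t) ≤ √(2·λ₁*). Then for any real a ≥ λ_{r+1}*, if σ₁(J_t)² ≤ a then σ₁(J_{t+1})² ≤ a. -/
open Matrix

/-- The largest singular value of a real matrix. -/
noncomputable def sigmaMax {m n : ℕ} (M : Matrix (Fin m) (Fin n) ℝ) : ℝ :=
  sSup {c : ℝ | ∃ v : EuclideanSpace ℝ (Fin n), ‖v‖ = 1 ∧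
    c = ‖(EuclideanSpace.equiv (Fin m) ℝ).symm (M.mulVec ((EuclideanSpace.equiv (Fin n) ℝ) v))‖}

/-- The smallest singular value (the `n`-th largest, for a matrix with `n` columns). -/
noncomputable def sigmaMin {m n : ℕ} (M : Matrix (Fin m) (Fin n) ℝ) : ℝ :=
  sInf {c : ℝ | ∃ v : EuclideanSpace ℝ (Fin n), ‖v‖ = 1 ∧
    c = ‖(EuclideanSpace.equiv (Fin m) ℝ).symm (M.mulVec ((EuclideanSpace.equiv (Fin n) ℝ) v))‖}

/-- Frobenius norm of a real matrix. -/
noncomputable def frobNorm {m n : ℕ} (M : Matrix (Fin m) (Fin n) ℝ) : ℝ :=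
  Real.sqrt (∑ i, ∑ j, (M i j) ^ 2)

/-- Gradient descent iterates `X_{t+1} = X_t + η (Σ - X_t X_tᵀ) X_t`. -/
noncomputable def gdIter {d r : ℕ} (S : Matrix (Fin d) (Fin d) ℝ) (η : ℝ)
    (X0 : Matrix (Fin d) (Fin r) ℝ) : ℕ → Matrix (Fin d) (Fin r) ℝ
  | 0 => X0
  | t + 1 => gdIter S η X0 t +
      η • ((S - gdIter S η X0 t * (gdIter S η X0 t)ᵀ) * gdIter S η X0 t)

/-- The top `r × r` block `U` (first `r` rows) of `X ∈ ℝ^{d×r}`. -/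
def topBlock {d r : ℕ} (h : r ≤ d) (X : Matrix (Fin d) (Fin r) ℝ) :
    Matrix (Fin r) (Fin r) ℝ :=
  fun i j => X (Fin.castLE h i) j

/-- The bottom `(d-r) × r` block `J` (last `d-r` rows) of `X ∈ ℝ^{d×r}`. -/
def botBlock {d r : ℕ} (X : Matrix (Fin d) (Fin r) ℝ) :
    Matrix (Fin (d - r)) (Fin r) ℝ :=
  fun i j => X ⟨r + (i : ℕ), by have := i.isLt; omega⟩ j

/-- The region `R = {X : σ₁(X)² ≤ 2λ₁*, σ₁(J)² ≤ λ_r* − Δ/2, σ_r(U)² ≥ Δ/4}`. -/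
def inR {d r : ℕ} (h : r ≤ d) (lam1 lamr Δ : ℝ) (X : Matrix (Fin d) (Fin r) ℝ) : Prop :=
  sigmaMax X ^ 2 ≤ 2 * lam1 ∧ sigmaMax (botBlock X) ^ 2 ≤ lamr - Δ / 2 ∧
    Δ / 4 ≤ sigmaMin (topBlock h X) ^ 2

/-- The region `R₂ = {X : σ₁(X)² ≤ 2λ₁*, σ₁(J)² ≤ λ_r* − Δ/2}`. -/
def inR2 {d r : ℕ} (lam1 lamr Δ : ℝ) (X : Matrix (Fin d) (Fin r) ℝ) : Prop :=
  sigmaMax X ^ 2 ≤ 2 * lam1 ∧ sigmaMax (botBlock X) ^ 2 ≤ lamr - Δ / 2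


open scoped Matrix.Norms.L2Operator InnerProductSpace

theorem norm_gd_block_step_le {V W Z : Type*}
    [NormedAddCommGroup V] [InnerProductSpace ℝ V] [CompleteSpace V]
    [NormedAddCommGroup W] [InnerProductSpace ℝ W] [CompleteSpace W]
    [NormedAddCommGroup Z] [InnerProductSpace ℝ Z] [CompleteSpace Z]
    (J : V →L[ℝ] W) (U : V →L[ℝ] Z) (L : W →L[ℝ] W) {c η : ℝ} (hη : 0 ≤ η)
    (hJ : ‖J‖ ^ 2 ≤ c) (hL : ‖L‖ ≤ c) (hU : η * ‖U‖ ^ 2 ≤ 1) (hc : 6 * (η * c) ≤ 1) :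
    ‖J + η • (L ∘L J - J ∘L (U.adjoint ∘L U + J.adjoint ∘L J))‖ ^ 2 ≤ c := by
  have hc0 : 0 ≤ c := (norm_nonneg L).trans hL
  have hJs : ‖J‖ ≤ √c := Real.le_sqrt_of_sq_le hJ
  have hs : √c ^ 2 = c := Real.sq_sqrt hc0
  have hs0 : 0 ≤ √c := Real.sqrt_nonneg c
  have hηc : 0 ≤ η * c := mul_nonneg hη hc0
  have hcubic (v : V) :
      ‖(1 / 2 : ℝ) • J v - η • J (J.adjoint (J v))‖ ≤ √c * (1 / 2 - η * c) * ‖v‖ := by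
    have hY (w : V) : 0 ≤ c * ‖w‖ ^ 2 - ‖J w‖ ^ 2 := by
      have h : ‖J w‖ ^ 2 ≤ (‖J‖ * ‖w‖) ^ 2 := by gcongr; exact J.le_opNorm w
      nlinarith [sq_nonneg ‖w‖]
    refine le_of_sq_le_sq ?_ (mul_nonneg (mul_nonneg hs0 (by linarith)) (norm_nonneg v))
    rw [mul_pow, mul_pow, hs]
    have h1 := hY v
    have h2 := hY (c • v - J.adjoint (J v))
    have h3 := sq_nonneg ‖c • v - J.adjoint (J v)‖
    have e1 : ⟪v, J.adjoint (J v)⟫_ℝ = ‖J v‖ ^ 2 := by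
      rw [ContinuousLinearMap.adjoint_inner_right, real_inner_self_eq_norm_sq]
    have e2 : ⟪J v, J (J.adjoint (J v))⟫_ℝ = ‖J.adjoint (J v)‖ ^ 2 := by
      rw [← ContinuousLinearMap.adjoint_inner_left, real_inner_self_eq_norm_sq]
    simp only [map_sub, map_smul, norm_sub_sq_real, norm_smul, inner_smul_left, inner_smul_right,
      e1, e2, mul_pow, Real.norm_eq_abs, sq_abs, conj_trivial] at h2 h3 ⊢
    have p0 : 0 ≤ 1 / 4 - 2 * (η * c) + 3 * (η * c) ^ 2 := by nlinarith
    have p1 : 0 ≤ η - 3 * η * (η * c) := by nlinarith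
    nlinarith [mul_nonneg p0 h1, mul_nonneg p1 h3, mul_nonneg (sq_nonneg η) h2]
  have hcontr (v : V) : ‖v - (2 * η) • U.adjoint (U v)‖ ≤ ‖v‖ := by
    refine le_of_sq_le_sq ?_ (norm_nonneg v)
    have e1 : ⟪v, U.adjoint (U v)⟫_ℝ = ‖U v‖ ^ 2 := by
      rw [ContinuousLinearMap.adjoint_inner_right, real_inner_self_eq_norm_sq]
    have h : ‖U.adjoint (U v)‖ ^ 2 ≤ (‖U‖ * ‖U v‖) ^ 2 := by
      gcongr
      simpa using U.adjoint.le_opNorm (U v)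
    simp only [norm_sub_sq_real, norm_smul, inner_smul_right, e1, mul_pow, Real.norm_eq_abs,
      sq_abs]
    nlinarith [mul_le_mul_of_nonneg_left h (sq_nonneg η),
      mul_nonneg (mul_nonneg hη (sub_nonneg.2 hU)) (sq_nonneg ‖U v‖)]
  have hmain : ‖J + η • (L ∘L J - J ∘L (U.adjoint ∘L U + J.adjoint ∘L J))‖ ≤ √c := by
    refine ContinuousLinearMap.opNorm_le_bound _ hs0 fun v ↦ ?_
    have hsplit : (J + η • (L ∘L J - J ∘L (U.adjoint ∘L U + J.adjoint ∘L J))) v =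
        ((1 / 2 : ℝ) • J v - η • J (J.adjoint (J v))) + η • L (J v) +
          (1 / 2 : ℝ) • J (v - (2 * η) • U.adjoint (U v)) := by
      simp only [_root_.add_apply, _root_.smul_apply, _root_.sub_apply,
        ContinuousLinearMap.comp_apply, map_add, map_sub, map_smul]
      module
    have hJv : ‖J v‖ ≤ √c * ‖v‖ := J.le_of_opNorm_le hJs v
    have hLJ : ‖η • L (J v)‖ ≤ η * (c * (√c * ‖v‖)) := by
      rw [norm_smul, Real.norm_of_nonneg hη]
      gcongr
      exact (L.le_of_opNorm_le hL _).trans (by gcongr)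
    have hhalf : ‖(1 / 2 : ℝ) • J (v - (2 * η) • U.adjoint (U v))‖ ≤ 1 / 2 * (√c * ‖v‖) := by
      rw [norm_smul, Real.norm_of_nonneg (by norm_num)]
      gcongr
      exact (J.le_of_opNorm_le hJs _).trans (by gcongr; exact hcontr v)
    rw [hsplit]
    refine (norm_add₃_le).trans ?_
    linarith [hcubic v]
  calc _ ≤ √c ^ 2 := by gcongr
    _ = c := hs

theorem sigmaMax_eq_l2_opNorm {m n : ℕ} (hn : 0 < n) (M : Matrix (Fin m) (Fin n) ℝ) :
    sigmaMax M = ‖M‖ := by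
  have : Nonempty (Fin n) := ⟨⟨0, hn⟩⟩
  rw [Matrix.l2_opNorm_def, ← ContinuousLinearMap.sSup_sphere_eq_norm, sigmaMax]
  congr 1
  ext c
  simp only [Set.mem_ofPred_eq, Set.mem_image, mem_sphere_zero_iff_norm, eq_comm (a := c)]
  rfl

theorem l2_opNorm_gd_block_step_le {m n p : ℕ} (J : Matrix (Fin m) (Fin n) ℝ) (U : Matrix (Fin p) (Fin n) ℝ)
    (L : Matrix (Fin m) (Fin m) ℝ) {c η : ℝ} (hη : 0 ≤ η)
    (hJ : ‖J‖ ^ 2 ≤ c) (hL : ‖L‖ ≤ c) (hU : η * ‖U‖ ^ 2 ≤ 1) (hc : 6 * (η * c) ≤ 1) :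
    ‖J + η • (L * J - J * (Uᵀ * U + Jᵀ * J))‖ ^ 2 ≤ c := by
  rw [Matrix.l2_opNorm_def] at hJ hL hU ⊢
  convert norm_gd_block_step_le _ _ _ hη hJ hL hU hc using 3
  have hadj {k l : ℕ} (A : Matrix (Fin k) (Fin l) ℝ) :
      (Matrix.toEuclideanLin ≪≫ₗ LinearMap.toContinuousLinearMap) Aᵀ =
        ((Matrix.toEuclideanLin ≪≫ₗ LinearMap.toContinuousLinearMap) A).adjoint := by
    rw [← Matrix.conjTranspose_eq_transpose_of_trivial]
    ext1 v
    exact congrArg (· v) (Matrix.toEuclideanLin_conjTranspose_eq_adjoint A)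
  have hmul {k l q : ℕ} (A : Matrix (Fin k) (Fin l) ℝ) (B : Matrix (Fin l) (Fin q) ℝ) :
      (Matrix.toEuclideanLin ≪≫ₗ LinearMap.toContinuousLinearMap) (A * B) =
        (Matrix.toEuclideanLin ≪≫ₗ LinearMap.toContinuousLinearMap) A ∘L
          (Matrix.toEuclideanLin ≪≫ₗ LinearMap.toContinuousLinearMap) B := by
    ext1 v
    exact congrArg (· v) (Matrix.toLpLin_mul 2 2 2 A B)
  simp only [map_add, map_smul, map_sub, hmul, hadj]

theorem sum_eq_sum_castLE_add_sum {d r : ℕ} (h : r ≤ d) (f : Fin d → ℝ) :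
    ∑ i, f i = ∑ i : Fin r, f (Fin.castLE h i) +
      ∑ i : Fin (d - r), f ⟨r + (i : ℕ), by have := i.isLt; omega⟩ := by
  rw [← Equiv.sum_comp (finCongr (Nat.add_sub_cancel' h)), Fin.sum_univ_add]
  rfl

theorem transpose_mul_self_eq_blocks {d r : ℕ} (h : r ≤ d) (X : Matrix (Fin d) (Fin r) ℝ) :
    Xᵀ * X = (topBlock h X)ᵀ * topBlock h X + (botBlock X)ᵀ * botBlock X := by
  ext i j
  simp only [Matrix.mul_apply, Matrix.add_apply, Matrix.transpose_apply]
  exact sum_eq_sum_castLE_add_sum h _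

theorem l2_opNorm_le_of_sq_le {m m' n : ℕ} (A : Matrix (Fin m) (Fin n) ℝ)
    (B : Matrix (Fin m') (Fin n) ℝ) (h : ∀ v, ∑ i, (A *ᵥ v) i ^ 2 ≤ ∑ i, (B *ᵥ v) i ^ 2) :
    ‖A‖ ≤ ‖B‖ := by
  conv_lhs => rw [Matrix.l2_opNorm_def]
  refine ContinuousLinearMap.opNorm_le_bound _ (norm_nonneg _) fun v ↦ ?_
  refine le_trans ?_ (Matrix.l2_opNorm_mulVec B v)
  refine le_of_sq_le_sq ?_ (norm_nonneg _)
  rw [EuclideanSpace.real_norm_sq_eq, EuclideanSpace.real_norm_sq_eq]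
  exact h v.ofLp

theorem l2_opNorm_topBlock_le {d r : ℕ} (h : r ≤ d) (X : Matrix (Fin d) (Fin r) ℝ) :
    ‖topBlock h X‖ ≤ ‖X‖ := by
  refine l2_opNorm_le_of_sq_le _ _ fun v ↦ ?_
  rw [sum_eq_sum_castLE_add_sum h]
  exact le_add_of_nonneg_right (Finset.sum_nonneg fun i _ ↦ sq_nonneg _)

theorem l2_opNorm_botBlock_le {d r : ℕ} (h : r ≤ d) (X : Matrix (Fin d) (Fin r) ℝ) :
    ‖botBlock X‖ ≤ ‖X‖ := by
  refine l2_opNorm_le_of_sq_le _ _ fun v ↦ ?_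
  rw [sum_eq_sum_castLE_add_sum h (fun i ↦ (X *ᵥ v) i ^ 2)]
  exact le_add_of_nonneg_left (Finset.sum_nonneg fun i _ ↦ sq_nonneg _)

theorem botBlock_gd_step {d r : ℕ} (h : r ≤ d) (lam : Fin d → ℝ) (η : ℝ)
    (X : Matrix (Fin d) (Fin r) ℝ) :
    botBlock (X + η • ((Matrix.diagonal lam - X * Xᵀ) * X)) =
      botBlock X + η • (Matrix.diagonal
          (fun i : Fin (d - r) ↦ lam ⟨r + (i : ℕ), by have := i.isLt; omega⟩) * botBlock X -
        botBlock X * ((topBlock h X)ᵀ * topBlock h X + (botBlock X)ᵀ * botBlock X)) := by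
  rw [← transpose_mul_self_eq_blocks, Matrix.sub_mul, Matrix.mul_assoc]
  ext i j
  simp only [botBlock, Matrix.add_apply, Matrix.smul_apply, Matrix.sub_apply,
    Matrix.diagonal_mul]
  rfl

/-- Lemma A.2: one-step invariance of `σ₁(J_t)² ≤ a` for any `a ≥ λ_{r+1}*`. -/
theorem J_bound_invariant (d r : ℕ) (hr : 0 < r) (hrd : r < d)
    (lam : Fin d → ℝ)
    (hmono : ∀ i j : Fin d, i ≤ j → lam j ≤ lam i)
    (hnn : ∀ i, 0 ≤ lam i)
    (hlam1 : 0 < lam ⟨0, by omega⟩)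
    (η : ℝ) (hη : 0 < η)
    (hηle : η ≤ 1 / (12 * lam ⟨0, by omega⟩))
    (X0 : Matrix (Fin d) (Fin r) ℝ) (t : ℕ)
    (hXt : sigmaMax (gdIter (Matrix.diagonal lam) η X0 t) ≤ Real.sqrt (2 * lam ⟨0, by omega⟩))
    (a : ℝ) (ha : lam ⟨r, hrd⟩ ≤ a)
    (hJt : sigmaMax (botBlock (gdIter (Matrix.diagonal lam) η X0 t)) ^ 2 ≤ a) :
    sigmaMax (botBlock (gdIter (Matrix.diagonal lam) η X0 (t + 1))) ^ 2 ≤ a := by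
  rw [sigmaMax_eq_l2_opNorm hr] at hXt hJt ⊢
  rw [gdIter, botBlock_gd_step hrd.le]
  set X := gdIter (Matrix.diagonal lam) η X0 t
  have hX : ‖X‖ ^ 2 ≤ 2 * lam ⟨0, by omega⟩ :=
    (Real.le_sqrt (norm_nonneg _) (by positivity)).1 hXt
  have hη12 : η * (12 * lam ⟨0, by omega⟩) ≤ 1 := (le_div_iff₀ (by positivity)).1 hηle
  have hU : ‖topBlock hrd.le X‖ ^ 2 ≤ 2 * lam ⟨0, by omega⟩ :=
    (pow_le_pow_left₀ (norm_nonneg _) (l2_opNorm_topBlock_le hrd.le X) 2).trans hX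
  have hJ : ‖botBlock X‖ ^ 2 ≤ 2 * lam ⟨0, by omega⟩ :=
    (pow_le_pow_left₀ (norm_nonneg _) (l2_opNorm_botBlock_le hrd.le X) 2).trans hX
  have hlam : lam ⟨r, hrd⟩ ≤ 2 * lam ⟨0, by omega⟩ := by
    linarith [hmono ⟨0, by omega⟩ ⟨r, hrd⟩ (Fin.mk_le_mk.2 hr.le)]
  refine (l2_opNorm_gd_block_step_le (c := max (‖botBlock X‖ ^ 2) (lam ⟨r, hrd⟩)) _ _ _ hη.le
    (le_max_left _ _) ?_ ?_ ?_).trans (max_le hJt ha)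
  · rw [Matrix.l2_opNorm_diagonal]
    refine le_trans ?_ (le_max_right _ _)
    refine (pi_norm_le_iff_of_nonneg (hnn _)).2 fun i ↦ ?_
    rw [Real.norm_of_nonneg (hnn _)]
    exact hmono _ _ (Fin.mk_le_mk.2 (Nat.le_add_right r i))
  · nlinarith [mul_le_mul_of_nonneg_left hU hη.le]
  · linarith [mul_le_mul_of_nonneg_left (max_le hJ hlam) hη.le]
end

section
/- Suppose Δ > 0, η ≤ Δ²/(32·λ₁*³), σ₁(X_t) ≤ √(2·λ₁*), and σ₁(J_t)² ≤ λ_r* − Δ/2. If σ_r(U_t)² ≥ Δ/4, then σ_r(U_{t+1})² ≥ Δ/4. -/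
open Matrix

section StepSize

variable {η Δ l L : ℝ}

lemma step_mul_le (hΔ : 0 < Δ) (hΔL : Δ ≤ L) (hηle : 32 * η * L ^ 3 ≤ Δ ^ 2) :
    32 * (η * L) ≤ 1 := by
  have hL : 0 < L := by linarith
  refine le_of_mul_le_mul_right ?_ (pow_pos hL 2)
  nlinarith

lemma eight_mul_pow_le (hη : 0 < η) (hΔ : 0 < Δ) (hΔL : Δ ≤ L)
    (hηle : 32 * η * L ^ 3 ≤ Δ ^ 2) :
    8 * η ^ 4 * L ^ 5 ≤ Δ / 4 * ((η * Δ) ^ 2 / 32) := by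
  have hL : 0 < L := by linarith
  have h4 : (32 * η * L ^ 3) ^ 2 ≤ (Δ ^ 2) ^ 2 := by gcongr
  have h5 : Δ ^ 4 ≤ Δ ^ 3 * L := by
    have := mul_le_mul_of_nonneg_left hΔL (pow_nonneg hΔ.le 3)
    linarith
  refine le_of_mul_le_mul_right ?_ hL
  nlinarith [mul_le_mul_of_nonneg_left (h4.trans_eq (by ring : _ = Δ ^ 4)) (sq_nonneg η),
    mul_le_mul_of_nonneg_left h5 (sq_nonneg η)]

lemma contraction_mul_growth_ge (hη : 0 < η) (hΔ : 0 < Δ) (hΔl : Δ ≤ l) (hlL : l ≤ L)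
    (hηle : 32 * η * L ^ 3 ≤ Δ ^ 2) :
    1 + 2 / 5 * (η * Δ) ≤
      (1 - 2 * η * (l - Δ / 2) - 2 * η * (Δ / 4)) * (1 + η * l) ^ 2 := by
  have hl : 0 < l := by linarith
  have hL : 0 < L := by linarith
  have hηL := step_mul_le hΔ (hΔl.trans hlL) hηle
  have hηl : η * l ≤ η * L := by gcongr
  have hηl0 : 0 < η * l := by positivity
  have hηΔ0 : 0 < η * Δ := by positivity
  have h1 : 32 * (η * l) ^ 2 ≤ η * Δ := by
    have h2 : 32 * η * L ^ 2 ≤ Δ := by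
      refine le_of_mul_le_mul_right ?_ hL
      nlinarith
    have h3 : η * (32 * η * L ^ 2) ≤ η * Δ := by gcongr
    have h4 : (η * l) ^ 2 ≤ (η * L) ^ 2 := by gcongr
    nlinarith
  have h6 : (η * l) ^ 3 ≤ 1 / 32 * (η * l) ^ 2 := by
    nlinarith [mul_le_mul_of_nonneg_right (hηl.trans (by linarith : η * L ≤ 1 / 32))
      (sq_nonneg (η * l))]
  nlinarith [mul_pos hηΔ0 hηl0, mul_nonneg hηΔ0.le (sq_nonneg (η * l))]

end StepSize

section QuadraticForms

variable {m n : Type*} [Fintype m] [Fintype n]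

lemma transpose_mulVec_dotProduct (A : Matrix m n ℝ) (x : m → ℝ) (y : n → ℝ) :
    (Aᵀ *ᵥ x) ⬝ᵥ y = x ⬝ᵥ (A *ᵥ y) := by
  rw [mulVec_transpose, dotProduct_mulVec]

lemma dotProduct_self_nonneg_real (v : n → ℝ) : 0 ≤ v ⬝ᵥ v :=
  Finset.sum_nonneg fun i _ => mul_self_nonneg (v i)

lemma dotProduct_sq_le (u v : n → ℝ) : (u ⬝ᵥ v) ^ 2 ≤ (u ⬝ᵥ u) * (v ⬝ᵥ v) := by
  simpa only [dotProduct, sq] using Finset.sum_mul_sq_le_sq_mul_sq Finset.univ u v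

/-- A lower bound on the singular values of a square matrix passes to its transpose. -/
lemma le_transpose_mulVec_of_le_mulVec {U : Matrix n n ℝ} {c : ℝ} (hc : 0 < c)
    (hU : ∀ v, c * (v ⬝ᵥ v) ≤ (U *ᵥ v) ⬝ᵥ (U *ᵥ v)) (y : n → ℝ) :
    c * (y ⬝ᵥ y) ≤ (Uᵀ *ᵥ y) ⬝ᵥ (Uᵀ *ᵥ y) := by
  have hinj : Function.Injective U.mulVecLin := by
    rw [← LinearMap.ker_eq_bot, LinearMap.ker_eq_bot']
    intro v hv
    have h := hU v
    rw [mulVecLin_apply] at hv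
    rw [hv, zero_dotProduct] at h
    exact dotProduct_self_eq_zero.mp
      (le_antisymm (by nlinarith) (dotProduct_self_nonneg_real v))
  obtain ⟨v, rfl⟩ := LinearMap.injective_iff_surjective.mp hinj y
  rw [mulVecLin_apply]
  set y := U *ᵥ v with hy
  have h1 : v ⬝ᵥ (Uᵀ *ᵥ y) = y ⬝ᵥ y := by
    rw [dotProduct_comm, transpose_mulVec_dotProduct]
  have h2 := dotProduct_sq_le v (Uᵀ *ᵥ y)
  rw [h1] at h2
  have h3 := hU v
  have hq := dotProduct_self_nonneg_real (Uᵀ *ᵥ y)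
  rcases (dotProduct_self_nonneg_real y).eq_or_lt with h0 | h0
  · rw [← h0]
    simpa using hq
  · refine le_of_mul_le_mul_left ?_ h0
    nlinarith [mul_le_mul_of_nonneg_right h3 hq, mul_le_mul_of_nonneg_left h2 hc.le]

/-- An upper bound on the singular values of a matrix passes to its transpose. -/
lemma transpose_mulVec_le_of_mulVec_le {A : Matrix m n ℝ} {L : ℝ} (hL : 0 ≤ L)
    (hA : ∀ v, (A *ᵥ v) ⬝ᵥ (A *ᵥ v) ≤ L * (v ⬝ᵥ v)) (y : m → ℝ) :
    (Aᵀ *ᵥ y) ⬝ᵥ (Aᵀ *ᵥ y) ≤ L * (y ⬝ᵥ y) := by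
  have h2 := dotProduct_sq_le y (A *ᵥ (Aᵀ *ᵥ y))
  rw [← transpose_mulVec_dotProduct] at h2
  have h3 := mul_le_mul_of_nonneg_left (hA (Aᵀ *ᵥ y)) (dotProduct_self_nonneg_real y)
  rcases (dotProduct_self_nonneg_real (Aᵀ *ᵥ y)).eq_or_lt with h0 | h0
  · rw [← h0]
    exact mul_nonneg hL (dotProduct_self_nonneg_real y)
  · refine le_of_mul_le_mul_left ?_ h0
    nlinarith

/-- A symmetric `B` with `0 ≤ B ≤ L` satisfies `B² ≤ L B`. -/
lemma mulVec_dotProduct_mulVec_le {B : Matrix n n ℝ} {L : ℝ} (hL : 0 < L) (hB : Bᵀ = B)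
    (h0 : ∀ u, 0 ≤ u ⬝ᵥ (B *ᵥ u)) (h1 : ∀ u, u ⬝ᵥ (B *ᵥ u) ≤ L * (u ⬝ᵥ u)) (y : n → ℝ) :
    (B *ᵥ y) ⬝ᵥ (B *ᵥ y) ≤ L * (y ⬝ᵥ (B *ᵥ y)) := by
  have h := h0 (L • y - B *ᵥ y)
  have h2 := h1 (B *ᵥ y)
  have h3 : y ⬝ᵥ (B *ᵥ (B *ᵥ y)) = (B *ᵥ y) ⬝ᵥ (B *ᵥ y) := by
    rw [← transpose_mulVec_dotProduct, hB]
  simp only [mulVec_sub, mulVec_smul, sub_dotProduct, dotProduct_sub, smul_dotProduct,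
    dotProduct_smul, smul_eq_mul, h3] at h
  have h4 : 0 ≤ L * (L * (y ⬝ᵥ (B *ᵥ y)) - (B *ᵥ y) ⬝ᵥ (B *ᵥ y)) := by linarith
  linarith [nonneg_of_mul_nonneg_right h4 hL]

/-- A squared form of the reverse triangle inequality. -/
lemma le_add_dotProduct_add {a f : n → ℝ} {δ : ℝ} (hδ : 0 < δ) (hδ1 : δ ≤ 1)
    (hf : f ⬝ᵥ f ≤ δ ^ 2 * (a ⬝ᵥ a)) :
    (1 - δ) ^ 2 * (a ⬝ᵥ a) ≤ (a + f) ⬝ᵥ (a + f) := by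
  have h := dotProduct_self_nonneg_real (δ • a + f)
  simp only [add_dotProduct, dotProduct_add, smul_dotProduct, dotProduct_smul,
    smul_eq_mul, dotProduct_comm f a] at h ⊢
  have h4 : 0 ≤ δ * (a ⬝ᵥ a + a ⬝ᵥ f + (a ⬝ᵥ f + f ⬝ᵥ f) - (1 - δ) ^ 2 * (a ⬝ᵥ a)) := by
    nlinarith [mul_le_mul_of_nonneg_left hf (sub_nonneg.mpr hδ1)]
  linarith [nonneg_of_mul_nonneg_right h4 hδ]

/-- Multiplying `U` on the right by `1 - η (UᵀU + JᵀJ)` moves the smallest singular value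
along the scalar map `s ↦ s (1 - 2 η j - 2 η s)`. -/
lemma le_sub_gram_mulVec {U : Matrix n n ℝ} {J : Matrix m n ℝ} {η s j L : ℝ}
    (hη : 0 ≤ η) (hs : 0 ≤ s) (hL : 0 < L) (hstep : 2 * η * (j + L + 2 * s) ≤ 1)
    (hUlo : ∀ y, s * (y ⬝ᵥ y) ≤ (Uᵀ *ᵥ y) ⬝ᵥ (Uᵀ *ᵥ y))
    (hUup : ∀ y, (Uᵀ *ᵥ y) ⬝ᵥ (Uᵀ *ᵥ y) ≤ L * (y ⬝ᵥ y))
    (hJ : ∀ v, (J *ᵥ v) ⬝ᵥ (J *ᵥ v) ≤ j * (v ⬝ᵥ v)) (y : n → ℝ) :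
    s * (1 - 2 * η * j - 2 * η * s) * (y ⬝ᵥ y) ≤
      (Uᵀ *ᵥ y - η • ((Uᵀ * U + Jᵀ * J) *ᵥ (Uᵀ *ᵥ y))) ⬝ᵥ
        (Uᵀ *ᵥ y - η • ((Uᵀ * U + Jᵀ * J) *ᵥ (Uᵀ *ᵥ y))) := by
  classical
  have hB (u : n → ℝ) : (U * Uᵀ - s • (1 : Matrix n n ℝ)) *ᵥ u = U *ᵥ (Uᵀ *ᵥ u) - s • u := by
    simp [sub_mulVec, smul_mulVec]
  have hq (u : n → ℝ) : u ⬝ᵥ ((U * Uᵀ - s • (1 : Matrix n n ℝ)) *ᵥ u) =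
      (Uᵀ *ᵥ u) ⬝ᵥ (Uᵀ *ᵥ u) - s * (u ⬝ᵥ u) := by
    rw [hB, dotProduct_sub, dotProduct_smul, smul_eq_mul, transpose_mulVec_dotProduct]
  have hBsq := mulVec_dotProduct_mulVec_le (B := U * Uᵀ - s • (1 : Matrix n n ℝ)) hL
    (by simp) (fun u => by rw [hq]; linarith [hUlo u])
    (fun u => by
      rw [hq]; nlinarith [hUup u, mul_nonneg hs (dotProduct_self_nonneg_real u)]) y
  rw [hq, hB] at hBsq
  have hlo := hUlo y
  have hz : (Uᵀ *ᵥ y) ⬝ᵥ (Uᵀ *ᵥ y) = y ⬝ᵥ (U *ᵥ (Uᵀ *ᵥ y)) := transpose_mulVec_dotProduct ..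
  simp only [sub_dotProduct, dotProduct_sub, smul_dotProduct, dotProduct_smul, smul_eq_mul,
    dotProduct_comm _ y, ← hz] at hBsq
  set z := Uᵀ *ᵥ y
  have hH : z ⬝ᵥ ((Uᵀ * U + Jᵀ * J) *ᵥ z) =
      (U *ᵥ z) ⬝ᵥ (U *ᵥ z) + (J *ᵥ z) ⬝ᵥ (J *ᵥ z) := by
    rw [add_mulVec, dotProduct_add, ← mulVec_mulVec, ← mulVec_mulVec, dotProduct_comm z,
      dotProduct_comm z, transpose_mulVec_dotProduct, transpose_mulVec_dotProduct]
  have hJz := hJ z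
  have hHH := dotProduct_self_nonneg_real ((Uᵀ * U + Jᵀ * J) *ᵥ z)
  simp only [sub_dotProduct, dotProduct_sub, smul_dotProduct, dotProduct_smul, smul_eq_mul,
    dotProduct_comm _ z, hH]
  nlinarith [mul_le_mul_of_nonneg_left hJz hη, mul_le_mul_of_nonneg_left hBsq hη,
    mul_nonneg (sub_nonneg.mpr hstep) (sub_nonneg.mpr hlo),
    mul_nonneg (mul_nonneg hη hη) hHH]

lemma gram_mulVec_dotProduct_le {U : Matrix n n ℝ} {J : Matrix m n ℝ} {L : ℝ} (hL : 0 < L)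
    (hX : ∀ v, (U *ᵥ v) ⬝ᵥ (U *ᵥ v) + (J *ᵥ v) ⬝ᵥ (J *ᵥ v) ≤ L * (v ⬝ᵥ v)) (v : n → ℝ) :
    ((Uᵀ * U + Jᵀ * J) *ᵥ v) ⬝ᵥ ((Uᵀ * U + Jᵀ * J) *ᵥ v) ≤ L ^ 2 * (v ⬝ᵥ v) := by
  have hH (v : n → ℝ) : v ⬝ᵥ ((Uᵀ * U + Jᵀ * J) *ᵥ v) =
      (U *ᵥ v) ⬝ᵥ (U *ᵥ v) + (J *ᵥ v) ⬝ᵥ (J *ᵥ v) := by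
    rw [add_mulVec, dotProduct_add, ← mulVec_mulVec, ← mulVec_mulVec, dotProduct_comm v,
      dotProduct_comm v, transpose_mulVec_dotProduct, transpose_mulVec_dotProduct]
  have h := mulVec_dotProduct_mulVec_le (B := Uᵀ * U + Jᵀ * J) hL
    (by simp [transpose_add, transpose_mul])
    (fun u => by
      rw [hH]
      exact add_nonneg (dotProduct_self_nonneg_real _) (dotProduct_self_nonneg_real _))
    (fun u => by rw [hH]; exact hX u) v
  rw [hH] at h
  nlinarith [mul_le_mul_of_nonneg_left (hX v) hL.le]

/-- One gradient step preserves the lower bound `Δ / 4` on the squared singular values of the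
top block, where the gradient step is expressed through the blocks `U` and `J`. -/
lemma le_gradient_step_mulVec [DecidableEq n] {U : Matrix n n ℝ} {J : Matrix m n ℝ}
    {μ : n → ℝ} {η Δ l L : ℝ} (hη : 0 < η) (hΔ : 0 < Δ) (hΔl : Δ ≤ l) (hlL : l ≤ L)
    (hηle : 32 * η * L ^ 3 ≤ Δ ^ 2) (hμl : ∀ i, l ≤ μ i) (hμL : ∀ i, μ i ≤ L)
    (hX : ∀ v, (U *ᵥ v) ⬝ᵥ (U *ᵥ v) + (J *ᵥ v) ⬝ᵥ (J *ᵥ v) ≤ 2 * L * (v ⬝ᵥ v))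
    (hJ : ∀ v, (J *ᵥ v) ⬝ᵥ (J *ᵥ v) ≤ (l - Δ / 2) * (v ⬝ᵥ v))
    (hU : ∀ v, Δ / 4 * (v ⬝ᵥ v) ≤ (U *ᵥ v) ⬝ᵥ (U *ᵥ v)) (v : n → ℝ) :
    Δ / 4 * (v ⬝ᵥ v) ≤
      ((U + η • (diagonal μ * U - U * (Uᵀ * U + Jᵀ * J))) *ᵥ v) ⬝ᵥ
        ((U + η • (diagonal μ * U - U * (Uᵀ * U + Jᵀ * J))) *ᵥ v) := by
  set W := U + η • (diagonal μ * U - U * (Uᵀ * U + Jᵀ * J)) with hW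
  rw [← transpose_transpose W]
  refine le_transpose_mulVec_of_le_mulVec (by positivity) (fun w => ?_) v
  have hL : 0 < L := by linarith
  have hL2 : 0 < 2 * L := by linarith
  have hUlo := le_transpose_mulVec_of_le_mulVec (by positivity) hU
  have hUup := transpose_mulVec_le_of_mulVec_le hL2.le
    (fun v => (le_add_of_nonneg_right (dotProduct_self_nonneg_real (J *ᵥ v))).trans (hX v))
  have hηL := step_mul_le hΔ (hΔl.trans hlL) hηle
  have hηl : η * l ≤ η * L := by gcongr
  have hηΔ : η * Δ ≤ η * l := by gcongr
  have hηΔ0 : 0 < η * Δ := by positivity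
  have hw := dotProduct_self_nonneg_real w
  set y := w + η • (diagonal μ *ᵥ w) with hy
  set H := Uᵀ * U + Jᵀ * J with hHdef
  have hdecomp : Wᵀ *ᵥ w = (Uᵀ *ᵥ y - η • (H *ᵥ (Uᵀ *ᵥ y))) +
      (η ^ 2) • (H *ᵥ (Uᵀ *ᵥ (diagonal μ *ᵥ w))) := by
    have hHt : Hᵀ = H := by simp [hHdef, transpose_add, transpose_mul]
    rw [hW, transpose_add, transpose_smul, transpose_sub, transpose_mul, transpose_mul, hHt,
      diagonal_transpose, hy]
    simp only [add_mulVec, smul_mulVec, sub_mulVec, ← mulVec_mulVec, mulVec_add, mulVec_smul]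
    module
  have hyw : (1 + η * l) ^ 2 * (w ⬝ᵥ w) ≤ y ⬝ᵥ y := by
    simp only [dotProduct, Finset.mul_sum]
    refine Finset.sum_le_sum fun i _ => ?_
    have h1 : y i = (1 + η * μ i) * w i := by
      simp [hy, mulVec_diagonal]; ring
    have h2 : (1 + η * l) ^ 2 ≤ (1 + η * μ i) ^ 2 := by
      have := hμl i
      have : 0 < l := by linarith
      gcongr
    rw [h1]
    nlinarith [mul_le_mul_of_nonneg_right h2 (mul_self_nonneg (w i))]
  have hDw : (diagonal μ *ᵥ w) ⬝ᵥ (diagonal μ *ᵥ w) ≤ L ^ 2 * (w ⬝ᵥ w) := by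
    simp only [dotProduct, Finset.mul_sum, mulVec_diagonal]
    refine Finset.sum_le_sum fun i _ => ?_
    have h2 : μ i ^ 2 ≤ L ^ 2 := by
      have := hμL i
      have : 0 ≤ μ i := by linarith [hμl i]
      gcongr
    nlinarith [mul_le_mul_of_nonneg_right h2 (mul_self_nonneg (w i))]
  have ha := le_sub_gram_mulVec hη.le (by positivity : 0 ≤ Δ / 4) hL2
    (by nlinarith) hUlo hUup hJ y
  have hf : ((η ^ 2) • (H *ᵥ (Uᵀ *ᵥ (diagonal μ *ᵥ w)))) ⬝ᵥ
      ((η ^ 2) • (H *ᵥ (Uᵀ *ᵥ (diagonal μ *ᵥ w)))) ≤ Δ / 4 * ((η * Δ) ^ 2 / 32) * (w ⬝ᵥ w) := by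
    have h1 := gram_mulVec_dotProduct_le hL2 hX (Uᵀ *ᵥ (diagonal μ *ᵥ w))
    have h2 := hUup (diagonal μ *ᵥ w)
    simp only [smul_dotProduct, dotProduct_smul, smul_eq_mul]
    have h3 := eight_mul_pow_le hη hΔ (hΔl.trans hlL) hηle
    calc _ ≤ η ^ 2 * (η ^ 2 * ((2 * L) ^ 2 * (2 * L * (L ^ 2 * (w ⬝ᵥ w))))) := by
          gcongr
          refine h1.trans ?_
          gcongr
          exact h2.trans (by gcongr)
      _ = 8 * η ^ 4 * L ^ 5 * (w ⬝ᵥ w) := by ring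
      _ ≤ _ := by gcongr
  have hκ := contraction_mul_growth_ge hη hΔ hΔl hlL hηle
  have hκ0 : 0 ≤ 1 - 2 * η * (l - Δ / 2) - 2 * η * (Δ / 4) := by nlinarith
  set a := Uᵀ *ᵥ y - η • (H *ᵥ (Uᵀ *ᵥ y))
  have haw : Δ / 4 * (1 + 2 / 5 * (η * Δ)) * (w ⬝ᵥ w) ≤ a ⬝ᵥ a := by
    calc _ ≤ Δ / 4 * ((1 - 2 * η * (l - Δ / 2) - 2 * η * (Δ / 4)) * (1 + η * l) ^ 2) *
          (w ⬝ᵥ w) := by gcongr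
      _ = Δ / 4 * (1 - 2 * η * (l - Δ / 2) - 2 * η * (Δ / 4)) *
          ((1 + η * l) ^ 2 * (w ⬝ᵥ w)) := by ring
      _ ≤ _ := le_trans (by gcongr) ha
  have hΔw : 0 ≤ Δ / 4 * (w ⬝ᵥ w) := by positivity
  have haw1 : Δ / 4 * (w ⬝ᵥ w) ≤ a ⬝ᵥ a := by
    nlinarith [mul_nonneg hΔw hηΔ0.le]
  have hfa := hf.trans
    (show _ ≤ (9 / 50 * (η * Δ)) ^ 2 * (a ⬝ᵥ a) by
      nlinarith [mul_le_mul_of_nonneg_left haw1 (sq_nonneg (η * Δ)),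
        mul_nonneg hΔw (sq_nonneg (η * Δ))])
  rw [hdecomp]
  refine le_trans ?_ (le_add_dotProduct_add (by positivity) (by linarith) hfa)
  refine le_trans ?_ (mul_le_mul_of_nonneg_left haw (sq_nonneg _))
  have h1 : 1 ≤ (1 - 9 / 50 * (η * Δ)) ^ 2 * (1 + 2 / 5 * (η * Δ)) := by
    have hx : η * Δ ≤ 1 / 32 := by linarith
    generalize η * Δ = x at hηΔ0 hx
    nlinarith [pow_pos hηΔ0 3, mul_pos hηΔ0 hηΔ0]
  nlinarith [mul_le_mul_of_nonneg_left h1 hΔw]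

end QuadraticForms

section SingularValues

variable {m n : ℕ}

lemma norm_symm_equiv_sq (v : Fin n → ℝ) :
    ‖(EuclideanSpace.equiv (Fin n) ℝ).symm v‖ ^ 2 = v ⬝ᵥ v := by
  rw [EuclideanSpace.real_norm_sq_eq]
  exact Finset.sum_congr rfl fun i _ => sq _

lemma exists_norm_eq_one_smul {v : Fin n → ℝ} (hv : v ≠ 0) :
    ∃ u : EuclideanSpace ℝ (Fin n), ‖u‖ = 1 ∧
      v = ‖(EuclideanSpace.equiv (Fin n) ℝ).symm v‖ • EuclideanSpace.equiv (Fin n) ℝ u := by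
  set x := (EuclideanSpace.equiv (Fin n) ℝ).symm v with hx
  have hx0 : x ≠ 0 := by simpa [hx] using hv
  refine ⟨‖x‖⁻¹ • x, norm_smul_inv_norm hx0, ?_⟩
  rw [map_smul, smul_smul, mul_inv_cancel₀ (norm_ne_zero_iff.mpr hx0), one_smul, hx,
    ContinuousLinearEquiv.apply_symm_apply]

lemma bddAbove_norm_mulVec (M : Matrix (Fin m) (Fin n) ℝ) :
    BddAbove {c : ℝ | ∃ v : EuclideanSpace ℝ (Fin n), ‖v‖ = 1 ∧
      c = ‖(EuclideanSpace.equiv (Fin m) ℝ).symm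
        (M.mulVec ((EuclideanSpace.equiv (Fin n) ℝ) v))‖} := by
  set T := (Matrix.toEuclideanLin M).toContinuousLinearMap
  refine ⟨‖T‖, ?_⟩
  rintro c ⟨v, hv, rfl⟩
  have h := T.le_opNorm v
  rwa [hv, mul_one] at h

lemma norm_mulVec_le_sigmaMax (M : Matrix (Fin m) (Fin n) ℝ) {u : EuclideanSpace ℝ (Fin n)}
    (hu : ‖u‖ = 1) :
    ‖(EuclideanSpace.equiv (Fin m) ℝ).symm (M *ᵥ EuclideanSpace.equiv (Fin n) ℝ u)‖ ≤
      sigmaMax M :=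
  le_csSup (bddAbove_norm_mulVec M) ⟨u, hu, rfl⟩

lemma sigmaMin_le_norm_mulVec (M : Matrix (Fin m) (Fin n) ℝ) {u : EuclideanSpace ℝ (Fin n)}
    (hu : ‖u‖ = 1) :
    sigmaMin M ≤
      ‖(EuclideanSpace.equiv (Fin m) ℝ).symm (M *ᵥ EuclideanSpace.equiv (Fin n) ℝ u)‖ :=
  csInf_le ⟨0, by rintro c ⟨v, -, rfl⟩; positivity⟩ ⟨u, hu, rfl⟩

lemma sigmaMin_nonneg (M : Matrix (Fin m) (Fin n) ℝ) : 0 ≤ sigmaMin M :=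
  Real.sInf_nonneg (by rintro c ⟨v, -, rfl⟩; positivity)

lemma mulVec_dotProduct_le_sigmaMax_sq (M : Matrix (Fin m) (Fin n) ℝ) (v : Fin n → ℝ) :
    (M *ᵥ v) ⬝ᵥ (M *ᵥ v) ≤ sigmaMax M ^ 2 * (v ⬝ᵥ v) := by
  rcases eq_or_ne v 0 with rfl | hv
  · simp
  obtain ⟨u, hu, hvu⟩ := exists_norm_eq_one_smul hv
  have h := norm_mulVec_le_sigmaMax M hu
  rw [← norm_symm_equiv_sq v, ← norm_symm_equiv_sq (M *ᵥ v), ← mul_pow]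
  conv_lhs => rw [hvu]
  rw [mulVec_smul, map_smul, norm_smul, norm_norm, mul_comm]
  gcongr

lemma sigmaMin_sq_le_mulVec_dotProduct (M : Matrix (Fin m) (Fin n) ℝ) (v : Fin n → ℝ) :
    sigmaMin M ^ 2 * (v ⬝ᵥ v) ≤ (M *ᵥ v) ⬝ᵥ (M *ᵥ v) := by
  rcases eq_or_ne v 0 with rfl | hv
  · simp
  obtain ⟨u, hu, hvu⟩ := exists_norm_eq_one_smul hv
  have h := sigmaMin_le_norm_mulVec M hu
  have h0 := sigmaMin_nonneg M
  rw [← norm_symm_equiv_sq v, ← norm_symm_equiv_sq (M *ᵥ v), ← mul_pow]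
  conv_rhs => rw [hvu]
  rw [mulVec_smul, map_smul, norm_smul, norm_norm, mul_comm]
  gcongr

lemma le_sigmaMin_sq (hn : 0 < n) {M : Matrix (Fin m) (Fin n) ℝ} {c : ℝ}
    (hM : ∀ v, c * (v ⬝ᵥ v) ≤ (M *ᵥ v) ⬝ᵥ (M *ᵥ v)) : c ≤ sigmaMin M ^ 2 := by
  refine Real.sqrt_le_left (sigmaMin_nonneg M) |>.mp (le_csInf ?_ ?_)
  · exact ⟨_, EuclideanSpace.single ⟨0, hn⟩ 1, by simp, rfl⟩
  · rintro _ ⟨v, hv, rfl⟩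
    refine Real.sqrt_le_left (norm_nonneg _) |>.mpr ?_
    rw [norm_symm_equiv_sq]
    have h := hM (EuclideanSpace.equiv (Fin n) ℝ v)
    rwa [← norm_symm_equiv_sq (EuclideanSpace.equiv (Fin n) ℝ v),
      ContinuousLinearEquiv.symm_apply_apply, hv, one_pow, mul_one] at h

end SingularValues

section Blocks

variable {d r : ℕ}

lemma sum_eq_sum_castLE_add (h : r ≤ d) (f : Fin d → ℝ) :
    ∑ i, f i = ∑ i : Fin r, f (Fin.castLE h i) +
      ∑ i : Fin (d - r), f ⟨r + (i : ℕ), by have := i.isLt; omega⟩ := by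
  obtain ⟨k, rfl⟩ := Nat.exists_eq_add_of_le h
  rw [Fin.sum_univ_add]
  congr 1
  exact (Equiv.sum_comp (finCongr (Nat.add_sub_cancel_left (n := r) (m := k)))
    fun i => f (Fin.natAdd r i)).symm

lemma mulVec_dotProduct_blocks (h : r ≤ d) (X : Matrix (Fin d) (Fin r) ℝ) (v : Fin r → ℝ) :
    (topBlock h X *ᵥ v) ⬝ᵥ (topBlock h X *ᵥ v) + (botBlock X *ᵥ v) ⬝ᵥ (botBlock X *ᵥ v) =
      (X *ᵥ v) ⬝ᵥ (X *ᵥ v) :=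
  (sum_eq_sum_castLE_add h fun i => (X *ᵥ v) i * (X *ᵥ v) i).symm

lemma transpose_mul_blocks (h : r ≤ d) (X : Matrix (Fin d) (Fin r) ℝ) :
    Xᵀ * X = (topBlock h X)ᵀ * topBlock h X + (botBlock X)ᵀ * botBlock X := by
  ext i j
  exact sum_eq_sum_castLE_add h fun k => X k i * X k j

lemma topBlock_gradient_step (h : r ≤ d) (lam : Fin d → ℝ) (η : ℝ)
    (X : Matrix (Fin d) (Fin r) ℝ) :
    topBlock h (X + η • ((diagonal lam - X * Xᵀ) * X)) =
      topBlock h X + η • (diagonal (fun i => lam (Fin.castLE h i)) * topBlock h X -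
        topBlock h X * ((topBlock h X)ᵀ * topBlock h X + (botBlock X)ᵀ * botBlock X)) := by
  rw [← transpose_mul_blocks, Matrix.sub_mul, Matrix.mul_assoc]
  ext i j
  simp only [topBlock, Matrix.add_apply, Matrix.smul_apply, Matrix.sub_apply, diagonal_mul]
  rfl

end Blocks

/-- Lemma A.3: one-step invariance of `σ_r(U_t)² ≥ Δ/4`. -/
theorem U_lower_invariant (d r : ℕ) (hr : 0 < r) (hrd : r < d)
    (lam : Fin d → ℝ)
    (hmono : ∀ i j : Fin d, i ≤ j → lam j ≤ lam i)
    (hnn : ∀ i, 0 ≤ lam i)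
    (η : ℝ) (hη : 0 < η)
    (hΔ : 0 < lam ⟨r - 1, by omega⟩ - lam ⟨r, hrd⟩)
    (hηle : η ≤ (lam ⟨r - 1, by omega⟩ - lam ⟨r, hrd⟩) ^ 2 / (32 * lam ⟨0, by omega⟩ ^ 3))
    (X0 : Matrix (Fin d) (Fin r) ℝ) (t : ℕ)
    (hXt : sigmaMax (gdIter (Matrix.diagonal lam) η X0 t) ≤ Real.sqrt (2 * lam ⟨0, by omega⟩))
    (hJt : sigmaMax (botBlock (gdIter (Matrix.diagonal lam) η X0 t)) ^ 2 ≤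
      lam ⟨r - 1, by omega⟩ - (lam ⟨r - 1, by omega⟩ - lam ⟨r, hrd⟩) / 2)
    (hUt : (lam ⟨r - 1, by omega⟩ - lam ⟨r, hrd⟩) / 4 ≤
      sigmaMin (topBlock hrd.le (gdIter (Matrix.diagonal lam) η X0 t)) ^ 2) :
    (lam ⟨r - 1, by omega⟩ - lam ⟨r, hrd⟩) / 4 ≤
      sigmaMin (topBlock hrd.le (gdIter (Matrix.diagonal lam) η X0 (t + 1))) ^ 2 := by
  set X := gdIter (Matrix.diagonal lam) η X0 t
  have hL : 0 < lam ⟨0, by omega⟩ := by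
    have := hmono ⟨0, by omega⟩ ⟨r - 1, by omega⟩ (Fin.mk_le_mk.mpr (by omega))
    linarith [hnn ⟨r, hrd⟩]
  refine le_sigmaMin_sq hr fun v => ?_
  rw [gdIter, topBlock_gradient_step]
  refine le_gradient_step_mulVec (l := lam ⟨r - 1, by omega⟩) (L := lam ⟨0, by omega⟩) hη hΔ
    (by linarith [hnn ⟨r, hrd⟩]) (hmono _ _ (Fin.mk_le_mk.mpr (by omega))) ?_
    (fun i => hmono _ _ (Fin.mk_le_mk.mpr (by omega)))
    (fun i => hmono _ _ (Fin.mk_le_mk.mpr (by omega))) (fun v => ?_) (fun v => ?_)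
    (fun v => ?_) v
  · rw [le_div_iff₀ (by positivity)] at hηle
    linarith
  · rw [mulVec_dotProduct_blocks]
    refine (mulVec_dotProduct_le_sigmaMax_sq X v).trans
      (mul_le_mul_of_nonneg_right ?_ (dotProduct_self_nonneg_real v))
    have h0 : 0 ≤ sigmaMax X :=
      (norm_nonneg _).trans (norm_mulVec_le_sigmaMax X
        (u := EuclideanSpace.single ⟨0, hr⟩ 1) (by simp))
    exact (Real.le_sqrt h0 (by positivity)).mp hXt
  · exact (mulVec_dotProduct_le_sigmaMax_sq _ v).trans
      (mul_le_mul_of_nonneg_right hJt (dotProduct_self_nonneg_real v))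
  · exact (mul_le_mul_of_nonneg_right hUt (dotProduct_self_nonneg_real v)).trans
      (sigmaMin_sq_le_mulVec_dotProduct _ v)
end
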